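/- arXiv:2204.12626 — 3 statements merged into one kernel-verified Lean document; each statement's English description precedes it below -/
import Mathlib

section
/- Let (G_n)_{n≥0} be a Gibonacci sequence with characteristic μ = G_1^2 - G_0·G_1 - G_0^2. For all k ≥ 1, (G_k^2 - G_0^2) - 3(G_{k+1}^2 - G_1^2) + (G_{k+2}^2 - G_2^2) equals 0 if k is even, and equals 4μ if k is odd. -/
/-- The characteristic of a shifted Gibonacci sequence alternates in sign. -/
theorem gibonacci_characteristic_shift (G : ℕ → ℤ)
    (hG : ∀ n : ℕ, G (n + 2) = G (n + 1) + G n) (k : ℕ) :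
    G (k + 1) ^ 2 - G k * G (k + 1) - G k ^ 2 =
      (-1) ^ k * (G 1 ^ 2 - G 0 * G 1 - G 0 ^ 2) := by
  induction k with
  | zero => simp
  | succ k ih =>
    rw [pow_succ, hG k]
    linear_combination -ih

/-- For a Gibonacci sequence `G` with characteristic `μ = G 1 ^ 2 - G 0 * G 1 - G 0 ^ 2`
and `k ≥ 1`, the value `(G k ² - G 0 ²) - 3(G (k+1) ² - G 1 ²) + (G (k+2) ² - G 2 ²)`
is `0` if `k` is even and `4μ` if `k` is odd. -/
theorem zero_versus_four_mu (G : ℕ → ℤ)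
    (hG : ∀ n : ℕ, G (n + 2) = G (n + 1) + G n)
    (μ : ℤ) (hμ : μ = (G 1) ^ 2 - G 0 * G 1 - (G 0) ^ 2) :
    ∀ k : ℕ, 1 ≤ k →
      (Even k → ((G k) ^ 2 - (G 0) ^ 2) - 3 * ((G (k + 1)) ^ 2 - (G 1) ^ 2) +
        ((G (k + 2)) ^ 2 - (G 2) ^ 2) = 0) ∧
      (Odd k → ((G k) ^ 2 - (G 0) ^ 2) - 3 * ((G (k + 1)) ^ 2 - (G 1) ^ 2) +
        ((G (k + 2)) ^ 2 - (G 2) ^ 2) = 4 * μ) := by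
  intro k _
  have hk := gibonacci_characteristic_shift G hG k
  rw [hG k, hG 0, zero_add, hμ]
  constructor
  · intro h
    rw [h.neg_one_pow] at hk
    linear_combination -2 * hk
  · intro h
    rw [h.neg_one_pow] at hk
    linear_combination -2 * hk
end

section
/- Let (G_n)_{n≥0} be a Gibonacci sequence. For all even k ≥ 0 and all ℓ ≥ 1, G_{k+ℓ}^2 - G_ℓ^2 = F_k · (G_0^2 · F_{k+2ℓ-2} + 2 · G_0 · G_1 · F_{k+2ℓ-1} + G_1^2 · F_{k+2ℓ}). -/
theorem gibonacci_succ_eq_fib (G : ℕ → ℤ) (hG : ∀ n : ℕ, G (n + 2) = G (n + 1) + G n) (n : ℕ) :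
    G (n + 1) = G 0 * Nat.fib n + G 1 * Nat.fib (n + 1) := by
  induction n using Nat.twoStepInduction with
  | zero => simp
  | one => simp [hG, add_comm]
  | more n h₀ h₁ =>
    rw [hG, h₀, h₁, Nat.fib_add_two (n := n + 1), Nat.fib_add_two (n := n)]
    push_cast
    ring

theorem cassini_fib_of_even {k : ℕ} (hk : Even k) :
    (Nat.fib (k + 1) : ℤ) ^ 2 - Nat.fib k * Nat.fib (k + 1) - (Nat.fib k : ℤ) ^ 2 = 1 := by
  obtain ⟨j, rfl⟩ := hk
  induction j with
  | zero => simp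
  | succ j ih =>
    rw [show j + 1 + (j + 1) = j + j + 2 by ring, Nat.fib_add_two (n := j + j + 1),
      Nat.fib_add_two (n := j + j)]
    push_cast
    linear_combination ih

theorem fib_add_cast (k n : ℕ) :
    (Nat.fib (k + n) : ℤ) =
      (Nat.fib (k + 1) - Nat.fib k) * Nat.fib n + Nat.fib k * Nat.fib (n + 1) := by
  cases k with
  | zero => simp
  | succ k =>
    rw [show k + 1 + n = k + n + 1 by ring, Nat.fib_add, Nat.fib_add_two (n := k)]
    push_cast
    ring


/-- For a Gibonacci sequence `G`, even `k ≥ 0`, and `ℓ ≥ 1`,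
`G (k+ℓ) ² - G ℓ ² = F k * (G 0 ² F (k+2ℓ-2) + 2 G 0 G 1 F (k+2ℓ-1) + G 1 ² F (k+2ℓ))`. -/
theorem gibonacci_sq_difference (G : ℕ → ℤ)
    (hG : ∀ n : ℕ, G (n + 2) = G (n + 1) + G n)
    (k ℓ : ℕ) (hk : Even k) (hℓ : 1 ≤ ℓ) :
    (G (k + ℓ)) ^ 2 - (G ℓ) ^ 2 =
      (Nat.fib k : ℤ) *
        ((G 0) ^ 2 * (Nat.fib (k + 2 * ℓ - 2) : ℤ) +
          2 * G 0 * G 1 * (Nat.fib (k + 2 * ℓ - 1) : ℤ) +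
          (G 1) ^ 2 * (Nat.fib (k + 2 * ℓ) : ℤ)) := by
  obtain ⟨m, rfl⟩ := Nat.exists_eq_add_of_le' hℓ
  have h₀ := fib_add_cast m m
  have h₁ := fib_add_cast m (m + 1)
  have h₂ : (Nat.fib (m + 2) : ℤ) = Nat.fib m + Nat.fib (m + 1) := mod_cast Nat.fib_add_two
  have h₃ : (Nat.fib (m + m + 2) : ℤ) = Nat.fib (m + m) + Nat.fib (m + (m + 1)) :=
    mod_cast Nat.fib_add_two
  have h₄ : (Nat.fib (m + m + 3) : ℤ) = Nat.fib (m + (m + 1)) + Nat.fib (m + m + 2) :=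
    mod_cast Nat.fib_add_two
  rw [← add_assoc, gibonacci_succ_eq_fib G hG (k + m), gibonacci_succ_eq_fib G hG m,
    show k + 2 * (m + 1) - 2 = k + (m + m) by omega,
    show k + 2 * (m + 1) - 1 = k + (m + (m + 1)) by omega,
    show k + 2 * (m + 1) = k + (m + m + 2) by omega, add_assoc k m 1,
    fib_add_cast k m, fib_add_cast k (m + 1), fib_add_cast k (m + m),
    fib_add_cast k (m + (m + 1)), fib_add_cast k (m + m + 2),
    show m + (m + 1) + 1 = m + m + 2 by ring, show m + m + 1 = m + (m + 1) by ring,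
    h₄, h₃, h₁, h₀, show m + 1 + 1 = m + 2 by ring, h₂]
  linear_combination
    (G 0 * Nat.fib m + G 1 * Nat.fib (m + 1)) ^ 2 * cassini_fib_of_even hk
end

section
/- Let G_0, G_1 ∈ ℤ with gcd(G_0, G_1) = 1, and let μ = G_1^2 - G_0·G_1 - G_0^2. Then gcd(2·G_0·G_1 + G_1^2, G_0^2 + G_1^2) = gcd(μ, 5). -/
/-- For coprime integers `G₀, G₁` with characteristic `μ = G₁² - G₀G₁ - G₀²`,
`gcd(2 G₀ G₁ + G₁², G₀² + G₁²) = gcd(μ, 5)`. -/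
theorem gcd_beta_eq_gcd_mu_five (G₀ G₁ : ℤ) (hcop : Int.gcd G₀ G₁ = 1)
    (μ : ℤ) (hμ : μ = G₁ ^ 2 - G₀ * G₁ - G₀ ^ 2) :
    Int.gcd (2 * G₀ * G₁ + G₁ ^ 2) (G₀ ^ 2 + G₁ ^ 2) = Int.gcd μ 5 := by
  subst hμ
  apply Nat.dvd_antisymm
  · have hA := Int.gcd_dvd_left (2 * G₀ * G₁ + G₁ ^ 2) (G₀ ^ 2 + G₁ ^ 2)
    have hB := Int.gcd_dvd_right (2 * G₀ * G₁ + G₁ ^ 2) (G₀ ^ 2 + G₁ ^ 2)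
    generalize Int.gcd (2 * G₀ * G₁ + G₁ ^ 2) (G₀ ^ 2 + G₁ ^ 2) = d at hA hB ⊢
    obtain ⟨x, hx⟩ := hA
    obtain ⟨y, hy⟩ := hB
    have h₅ : (d : ℤ) ∣ 5 := by
      obtain ⟨r, s, hrs⟩ : IsCoprime (G₀ ^ 3) (G₁ ^ 3) :=
        (Int.isCoprime_iff_gcd_eq_one.mpr hcop).pow
      have h₀ : (d : ℤ) ∣ 5 * G₀ ^ 3 :=
        ⟨(5 * G₀ + 2 * G₁) * y - (G₀ + 2 * G₁) * x, by
          linear_combination (5 * G₀ + 2 * G₁) * hy - (G₀ + 2 * G₁) * hx⟩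
      have h₁ : (d : ℤ) ∣ 5 * G₁ ^ 3 :=
        ⟨(G₁ - 2 * G₀) * x + 4 * G₁ * y, by
          linear_combination (G₁ - 2 * G₀) * hx + 4 * G₁ * hy⟩
      have h : (5 : ℤ) = r * (5 * G₀ ^ 3) + s * (5 * G₁ ^ 3) := by
        linear_combination -5 * hrs
      rw [h]
      exact dvd_add (h₀.mul_left r) (h₁.mul_left s)
    refine Int.dvd_gcd ?_ h₅
    obtain ⟨k, hk⟩ := h₅
    exact ⟨2 * x - y - k * G₀ * G₁, by
      linear_combination 2 * hx - hy - G₀ * G₁ * hk⟩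
  · by_cases h : (5 : ℤ) ∣ G₁ ^ 2 - G₀ * G₁ - G₀ ^ 2
    · have hp : Prime (5 : ℤ) := by norm_num
      obtain ⟨k, hk⟩ := h
      obtain ⟨u, hu⟩ : (5 : ℤ) ∣ 2 * G₀ + G₁ := hp.dvd_of_dvd_pow (n := 2)
        ⟨k + G₀ * G₁ + G₀ ^ 2, by linear_combination hk⟩
      have h₅ := Int.gcd_dvd_right (G₁ ^ 2 - G₀ * G₁ - G₀ ^ 2) 5
      exact Int.dvd_gcd
        (h₅.trans ⟨G₁ * u, by linear_combination G₁ * hu⟩)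
        (h₅.trans ⟨(G₁ - 2 * G₀) * u + G₀ ^ 2, by
          linear_combination (G₁ - 2 * G₀) * hu⟩)
    · have hp : Prime (5 : ℤ) := by norm_num
      have h₁ : Int.gcd (G₁ ^ 2 - G₀ * G₁ - G₀ ^ 2) 5 = 1 :=
        Int.isCoprime_iff_gcd_eq_one.mp ((hp.coprime_iff_not_dvd.mpr h).symm)
      rw [h₁]
      exact one_dvd _
end
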